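/- The asteroids algebra A(m, k) is a differential graded algebra: its differential satisfies ∂ ∘ ∂ = 0, and the Leibniz rule ∂(μ₂(a, b)) = μ₂(∂a, b) + μ₂(a, ∂b) holds for all a, b ∈ A(m, k) (coefficients in F₂). -/

import Mathlib

open scoped Classical BigOperators

noncomputable section

/-- `(i, j)` is a crossing pair for `(S, f)`. -/
def IsCrossing (S : Set ℤ) (f : ℤ → ℤ) (i j : ℤ) : Prop :=
  i ∈ S ∧ j ∈ S ∧ i < j ∧ f j < f i

/-- `(S, f)` is an `mℤ`-lifted partial permutation on `k` letters. -/
structure IsALPP (m k : ℕ) (S : Set ℤ) (f : ℤ → ℤ) : Prop where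
  invariant : ∀ x : ℤ, x ∈ S ↔ x + m ∈ S
  equivariant : ∀ x ∈ S, f (x + m) = f x + m
  orbits : ((fun x : ℤ => (x : ZMod m)) '' S).ncard = k
  inj : ∀ x ∈ S, ∀ y ∈ S, ((f x : ZMod m) = (f y : ZMod m)) → (x : ZMod m) = (y : ZMod m)

/-- Complete invariant of the `mℤ`-translation class of a pair `(i, j)`. -/
def crossKeyA (m : ℕ) (p : ℤ × ℤ) : ZMod m × ℤ := ((p.1 : ZMod m), p.2 - p.1)

/-- The set of crossings of `(S, f)` (translation classes of crossing pairs). -/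
def crossingsA (m : ℕ) (S : Set ℤ) (f : ℤ → ℤ) : Set (ZMod m × ℤ) :=
  crossKeyA m '' {p : ℤ × ℤ | IsCrossing S f p.1 p.2}

/-- The number of crossings. -/
def crossCountA (m : ℕ) (S : Set ℤ) (f : ℤ → ℤ) : ℕ := (crossingsA m S f).ncard

/-- The set whose cardinality (halved) is the weight `w_a(S, f)`,
for `a ∈ 1/2 + ℤ`. -/
def weightSetA (a : ℚ) (S : Set ℤ) (f : ℤ → ℤ) : Set ℤ :=
  {i | i ∈ S ∧ (((i : ℚ) < a ∧ a < (f i : ℚ)) ∨ ((f i : ℚ) < a ∧ a < (i : ℚ)))}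

/-- The weight `w_a(S, f)`. -/
def weightA (a : ℚ) (S : Set ℤ) (f : ℤ → ℤ) : ℚ := (weightSetA a S f).ncard / 2

/-- The resolution `f_{⟨i,j⟩}` of `f` at the crossing `⟨i, j⟩`. -/
def resolveA (m : ℕ) (f : ℤ → ℤ) (i j : ℤ) : ℤ → ℤ := fun x =>
  if (m : ℤ) ∣ (x - i) then f j + (x - i)
  else if (m : ℤ) ∣ (x - j) then f i + (x - j)
  else f x

/-- The basis of the asteroids algebra: `mℤ`-lifted partial permutations,
normalized to be the identity off their domain. -/
def AstIdx (m k : ℕ) : Type :=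
  {P : Set ℤ × (ℤ → ℤ) // IsALPP m k P.1 P.2 ∧ ∀ x ∉ P.1, P.2 x = x}

/-- The ground ring `F₂[v₁, …, v_m]` of the asteroids algebra. -/
abbrev AstRing (m : ℕ) := MvPolynomial (Fin m) (ZMod 2)

/-- The exponent vector `(w_{l-1/2}(f) - w_{l-1/2}(f'))_{l=1}^m` appearing in
the differential of the asteroids algebra. -/
def expDiffA (m : ℕ) (S : Set ℤ) (f f' : ℤ → ℤ) : Fin m →₀ ℕ :=
  Finsupp.equivFunOnFinite.symm fun l =>
    ((weightSetA (((l : ℕ) : ℚ) + 1/2) S f).ncard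
      - (weightSetA (((l : ℕ) : ℚ) + 1/2) S f').ncard) / 2

/-- The exponent vector for the product of the asteroids algebra. -/
def expMulA (m : ℕ) (S T : Set ℤ) (f g : ℤ → ℤ) : Fin m →₀ ℕ :=
  Finsupp.equivFunOnFinite.symm fun l =>
    ((weightSetA (((l : ℕ) : ℚ) + 1/2) S f).ncard
      + (weightSetA (((l : ℕ) : ℚ) + 1/2) T g).ncard
      - (weightSetA (((l : ℕ) : ℚ) + 1/2) S (g ∘ f)).ncard) / 2

/-- Crossings of `(S, f)` whose resolution drops the crossing number by one
and agrees with `f'` on `S`. -/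
def resCrossSetA (m : ℕ) (S : Set ℤ) (f f' : ℤ → ℤ) : Set (ZMod m × ℤ) :=
  crossKeyA m '' {p : ℤ × ℤ | IsCrossing S f p.1 p.2 ∧
    Set.EqOn (resolveA m f p.1 p.2) f' S ∧
    crossCountA m S (resolveA m f p.1 p.2) + 1 = crossCountA m S f}

/-- The structure constants of the differential of the asteroids algebra. -/
def MdiffA (m k : ℕ) (p q : AstIdx m k) : AstRing m :=
  if q.1.1 = p.1.1 then
    MvPolynomial.monomial (expDiffA m p.1.1 p.1.2 q.1.2)
      ((resCrossSetA m p.1.1 p.1.2 q.1.2).ncard : ZMod 2)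
  else 0

/-- The structure constants of the product of the asteroids algebra. -/
def MmulA (m k : ℕ) (p q s : AstIdx m k) : AstRing m :=
  if q.1.1 = p.1.2 '' p.1.1 ∧
      crossCountA m p.1.1 (q.1.2 ∘ p.1.2)
        = crossCountA m p.1.1 p.1.2 + crossCountA m q.1.1 q.1.2 ∧
      s.1.1 = p.1.1 ∧ Set.EqOn s.1.2 (q.1.2 ∘ p.1.2) p.1.1
  then MvPolynomial.monomial (expMulA m p.1.1 q.1.1 p.1.2 q.1.2) 1
  else 0



namespace Asteroids

variable {m k : ℕ}

section ShiftEquivariance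

variable {S : Set ℤ} {f : ℤ → ℤ}

theorem add_mem (H : IsALPP m k S f) {a x : ℤ} (ha : (m : ℤ) ∣ a) (hx : x ∈ S) : x + a ∈ S := by
  obtain ⟨c, rfl⟩ := ha
  induction c using Int.induction_on with
  | zero => simpa using hx
  | succ n ih =>
    have := (H.invariant _).1 ih
    rwa [show x + (m : ℤ) * (n + 1) = x + m * n + m by ring]
  | pred n ih =>
    rw [H.invariant]
    rwa [show x + (m : ℤ) * (-n - 1) + m = x + m * (-n) by ring]

theorem map_add (H : IsALPP m k S f) {a x : ℤ} (ha : (m : ℤ) ∣ a) (hx : x ∈ S) :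
    f (x + a) = f x + a := by
  obtain ⟨c, rfl⟩ := ha
  induction c using Int.induction_on with
  | zero => simp
  | succ n ih =>
    have := H.equivariant _ (add_mem H (Dvd.intro _ rfl : (m : ℤ) ∣ m * n) hx)
    rw [show x + (m : ℤ) * (n + 1) = x + m * n + m by ring, this, ih]
    ring
  | pred n ih =>
    have := H.equivariant _ (add_mem H (Dvd.intro _ rfl : (m : ℤ) ∣ m * (-n - 1)) hx)
    rw [show x + (m : ℤ) * (-n - 1) + m = x + m * (-n) by ring, ih] at this
    linarith

theorem dvd_of_dvd_map (H : IsALPP m k S f) {x y : ℤ} (hx : x ∈ S) (hy : y ∈ S)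
    (h : (m : ℤ) ∣ f y - f x) : (m : ℤ) ∣ y - x := by
  rw [← ZMod.intCast_eq_intCast_iff_dvd_sub] at h ⊢
  exact H.inj x hx y hy h

theorem injOn (H : IsALPP m k S f) : Set.InjOn f S := by
  intro x hx y hy h
  have hd := dvd_of_dvd_map H hx hy (by simp [h])
  have := map_add H hd hx
  rw [show x + (y - x) = y by ring] at this
  linarith

theorem exists_displacement_bound (hm : 1 ≤ m) (H : IsALPP m k S f) :
    ∃ B : ℤ, ∀ x ∈ S, |f x - x| ≤ B := by
  have hfin : ((fun x => |f x - x|) '' (S ∩ Set.Ico 0 (m : ℤ))).Finite :=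
    ((Set.finite_Ico _ _).inter_of_right S).image _
  obtain ⟨B, hB⟩ := hfin.bddAbove
  refine ⟨B, fun x hx => ?_⟩
  have hd : (m : ℤ) ∣ -(m * (x / m)) := by simp
  have hmod : x + -(m * (x / m)) = x % m := by
    have := Int.emod_add_mul_ediv x m
    linarith
  have hS := add_mem H hd hx
  have hf := map_add H hd hx
  rw [hmod] at hS hf
  have := hB ⟨x % m, ⟨hS, Int.emod_nonneg _ (by omega), Int.emod_lt_of_pos _ (by omega)⟩, rfl⟩
  rw [show f x - x = f (x % m) - x % m by rw [hf, ← hmod]; ring]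
  exact this

end ShiftEquivariance

section Keys

theorem crossKeyA_eq_iff {p q : ℤ × ℤ} :
    crossKeyA m p = crossKeyA m q ↔ ∃ a : ℤ, (m : ℤ) ∣ a ∧ q = (p.1 + a, p.2 + a) := by
  simp only [crossKeyA, ZMod.intCast_eq_intCast_iff_dvd_sub, Prod.ext_iff]
  constructor
  · rintro ⟨h1, h2⟩
    exact ⟨_, h1, by ring, by linarith⟩
  · rintro ⟨a, ha, h1, h2⟩
    rw [h1, h2]
    exact ⟨by simpa using ha, by ring⟩

theorem ncard_image_crossKeyA_le {X Y : Set (ℤ × ℤ)} (F : ℤ × ℤ → ℤ × ℤ)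
    (hfin : (crossKeyA m '' Y).Finite) (hF : ∀ p ∈ X, F p ∈ Y)
    (hinj : ∀ p ∈ X, ∀ q ∈ X, crossKeyA m (F p) = crossKeyA m (F q) →
      crossKeyA m p = crossKeyA m q) :
    (crossKeyA m '' X).ncard ≤ (crossKeyA m '' Y).ncard := by
  have hch : ∀ c ∈ crossKeyA m '' X, ∃ p ∈ X, crossKeyA m p = c := fun c hc => hc
  choose! g hgX hg using hch
  refine Set.ncard_le_ncard_of_injOn (fun c => crossKeyA m (F (g c))) ?_ ?_ hfin
  · exact fun c hc => ⟨_, hF _ (hgX c hc), rfl⟩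
  · intro c hc d hd h
    rw [← hg c hc, ← hg d hd]
    exact hinj _ (hgX c hc) _ (hgX d hd) h

theorem crossingsA_eq_image_reps (hm : 1 ≤ m) {S : Set ℤ} {f : ℤ → ℤ} (H : IsALPP m k S f) :
    crossingsA m S f =
      crossKeyA m '' {p | IsCrossing S f p.1 p.2 ∧ p.1 ∈ Set.Ico 0 (m : ℤ)} := by
  apply subset_antisymm
  · rintro _ ⟨⟨i, j⟩, ⟨hi, hj, hij, hf⟩, rfl⟩
    have hd : (m : ℤ) ∣ -(m * (i / m)) := by simp
    refine ⟨(i + -(m * (i / m)), j + -(m * (i / m))), ⟨⟨add_mem H hd hi, add_mem H hd hj,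
      by simpa using hij, ?_⟩, ?_⟩, (crossKeyA_eq_iff (p := (i, j)).2 ⟨_, hd, rfl⟩).symm⟩
    · rw [map_add H hd hi, map_add H hd hj]
      linarith
    · have := Int.emod_add_mul_ediv i m
      have h1 := Int.emod_nonneg i (show (m : ℤ) ≠ 0 by omega)
      have h2 := Int.emod_lt_of_pos i (show 0 < (m : ℤ) by omega)
      exact ⟨by dsimp only; linarith, by dsimp only; linarith⟩
  · exact Set.image_mono fun p hp => hp.1

theorem finite_crossing_reps (hm : 1 ≤ m) {S : Set ℤ} {f : ℤ → ℤ} (H : IsALPP m k S f) :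
    {p : ℤ × ℤ | IsCrossing S f p.1 p.2 ∧ p.1 ∈ Set.Ico 0 (m : ℤ)}.Finite := by
  obtain ⟨B, hB⟩ := exists_displacement_bound hm H
  refine ((Set.finite_Ico 0 (m : ℤ)).prod (Set.finite_Icc 0 (m + 2 * B))).subset ?_
  rintro ⟨i, j⟩ ⟨⟨hi, hj, hij, hf⟩, h0⟩
  have h1 := abs_le.1 (hB i hi)
  have h2 := abs_le.1 (hB j hj)
  simp only [Set.mem_Ico, Set.mem_prod, Set.mem_Icc] at *
  omega

theorem finite_crossingsA (hm : 1 ≤ m) {S : Set ℤ} {f : ℤ → ℤ} (H : IsALPP m k S f) :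
    (crossingsA m S f).Finite := by
  rw [crossingsA_eq_image_reps hm H]
  exact (finite_crossing_reps hm H).image _

theorem crossingsA_congr {S : Set ℤ} {f g : ℤ → ℤ} (h : Set.EqOn f g S) :
    crossingsA m S f = crossingsA m S g := by
  unfold crossingsA
  congr 1
  ext ⟨i, j⟩
  simp only [Set.mem_ofPred_eq, IsCrossing]
  constructor <;> rintro ⟨hi, hj, hij, hf⟩ <;> refine ⟨hi, hj, hij, ?_⟩
  · rwa [← h hi, ← h hj]
  · rwa [h hi, h hj]

theorem crossCountA_congr {S : Set ℤ} {f g : ℤ → ℤ} (h : Set.EqOn f g S) :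
    crossCountA m S f = crossCountA m S g := by
  rw [crossCountA, crossCountA, crossingsA_congr h]

end Keys

/-- The reflection exchanging `i + a` and `j + a` for every multiple `a` of `m`. -/
def reflection (m : ℕ) (i j x : ℤ) : ℤ :=
  if (m : ℤ) ∣ x - i then x + (j - i) else if (m : ℤ) ∣ x - j then x - (j - i) else x

section Reflection

variable {i j x : ℤ}

theorem reflection_cases (i j x : ℤ) :
    (∃ a, (m : ℤ) ∣ a ∧ x = i + a ∧ reflection m i j x = j + a) ∨
    (∃ a, (m : ℤ) ∣ a ∧ x = j + a ∧ reflection m i j x = i + a) ∨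
    (¬ (m : ℤ) ∣ x - i ∧ ¬ (m : ℤ) ∣ x - j ∧ reflection m i j x = x) := by
  unfold reflection
  split_ifs with h1 h2
  · exact Or.inl ⟨_, h1, by ring, by ring⟩
  · exact Or.inr (Or.inl ⟨_, h2, by ring, by ring⟩)
  · exact Or.inr (Or.inr ⟨h1, h2, rfl⟩)

theorem reflection_left {a : ℤ} (ha : (m : ℤ) ∣ a) : reflection m i j (i + a) = j + a := by
  rw [reflection, if_pos (by simpa using ha)]
  ring

theorem reflection_right (hij : ¬ (m : ℤ) ∣ j - i) {a : ℤ} (ha : (m : ℤ) ∣ a) :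
    reflection m i j (j + a) = i + a := by
  rw [reflection, if_neg, if_pos (by simpa using ha)]
  · ring
  · rwa [show j + a - i = j - i + a by ring, dvd_add_left ha]

theorem reflection_reflection (hij : ¬ (m : ℤ) ∣ j - i) (x : ℤ) :
    reflection m i j (reflection m i j x) = x := by
  obtain ⟨a, ha, h1, h2⟩ | ⟨a, ha, h1, h2⟩ | ⟨_, _, h⟩ := reflection_cases (m := m) i j x
  · rw [h2, reflection_right hij ha, h1]
  · rw [h2, reflection_left ha, h1]
  · rw [h, h]

theorem reflection_add {a : ℤ} (ha : (m : ℤ) ∣ a) (x : ℤ) :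
    reflection m i j (x + a) = reflection m i j x + a := by
  unfold reflection
  simp only [show x + a - i = x - i + a by ring, show x + a - j = x - j + a by ring,
    dvd_add_left ha]
  split_ifs <;> ring

theorem reflection_comm (hij : ¬ (m : ℤ) ∣ j - i) (x : ℤ) :
    reflection m j i x = reflection m i j x := by
  have hji : ¬ (m : ℤ) ∣ i - j := by rwa [dvd_sub_comm]
  obtain ⟨a, ha, h1, h2⟩ | ⟨a, ha, h1, h2⟩ | ⟨h1, h2, h⟩ := reflection_cases (m := m) i j x
  · rw [h2, h1, reflection_right hji ha]
  · rw [h2, h1, reflection_left ha]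
  · rw [h, reflection, if_neg h2, if_neg h1]

theorem reflection_mem {S : Set ℤ} {f : ℤ → ℤ} (H : IsALPP m k S f) (hi : i ∈ S) (hj : j ∈ S)
    (hx : x ∈ S) : reflection m i j x ∈ S := by
  obtain ⟨a, ha, h1, h2⟩ | ⟨a, ha, h1, h2⟩ | ⟨_, _, h⟩ := reflection_cases (m := m) i j x
  · exact h2 ▸ add_mem H ha hj
  · exact h2 ▸ add_mem H ha hi
  · rwa [h]

theorem resolveA_eq {S : Set ℤ} {f : ℤ → ℤ} (H : IsALPP m k S f) (hi : i ∈ S) (hj : j ∈ S)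
    (x : ℤ) : resolveA m f i j x = f (reflection m i j x) := by
  unfold resolveA reflection
  split_ifs with h1 h2
  · rw [← map_add H h1 hj]
    congr 1
    ring
  · rw [← map_add H h2 hi]
    congr 1
    ring
  · rfl

/-- Conjugating a reflection by an equivariant map gives the reflection of the images. -/
theorem map_reflection {S : Set ℤ} {f : ℤ → ℤ} (H : IsALPP m k S f) (hi : i ∈ S) (hj : j ∈ S)
    (hij : ¬ (m : ℤ) ∣ j - i) (hx : x ∈ S) :
    f (reflection m i j x) = reflection m (f i) (f j) (f x) := by
  have hf : ¬ (m : ℤ) ∣ f j - f i := fun h => hij (dvd_of_dvd_map H hi hj h)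
  obtain ⟨a, ha, h1, h2⟩ | ⟨a, ha, h1, h2⟩ | ⟨h1, h2, h⟩ := reflection_cases (m := m) i j x
  · rw [h2, h1, map_add H ha hi, map_add H ha hj, reflection_left ha]
  · rw [h2, h1, map_add H ha hi, map_add H ha hj, reflection_right hf ha]
  · rw [h, reflection, if_neg, if_neg]
    · exact fun h => h2 (dvd_of_dvd_map H hj hx h)
    · exact fun h => h1 (dvd_of_dvd_map H hi hx h)

theorem isALPP_comp_reflection {S : Set ℤ} {f : ℤ → ℤ} (H : IsALPP m k S f) (hi : i ∈ S)
    (hj : j ∈ S) (hij : ¬ (m : ℤ) ∣ j - i) : IsALPP m k S (f ∘ reflection m i j) where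
  invariant := H.invariant
  equivariant x hx := by
    simp only [Function.comp_apply, reflection_add dvd_rfl]
    exact map_add H dvd_rfl (reflection_mem H hi hj hx)
  orbits := H.orbits
  inj x hx y hy h := by
    have h1 := H.inj _ (reflection_mem H hi hj hx) _ (reflection_mem H hi hj hy) h
    rw [ZMod.intCast_eq_intCast_iff_dvd_sub] at h1 ⊢
    have h2 := reflection_add (i := i) (j := j) h1 (reflection m i j x)
    rw [add_sub_cancel, reflection_reflection hij, reflection_reflection hij] at h2
    rw [h2]
    simpa using h1

theorem image_comp_reflection {S : Set ℤ} {f : ℤ → ℤ} (H : IsALPP m k S f) (hi : i ∈ S)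
    (hj : j ∈ S) (hij : ¬ (m : ℤ) ∣ j - i) : (fun x => f (reflection m i j x)) '' S = f '' S := by
  ext y
  constructor
  · rintro ⟨x, hx, rfl⟩
    exact ⟨_, reflection_mem H hi hj hx, rfl⟩
  · rintro ⟨x, hx, rfl⟩
    exact ⟨_, reflection_mem H hi hj hx, by simp only [reflection_reflection hij]⟩

end Reflection

section Length

variable {S : Set ℤ} {f : ℤ → ℤ} {i j : ℤ}

theorem map_reflection_cases {x : ℤ} (H : IsALPP m k S f) (hi : i ∈ S) (hj : j ∈ S) :
    (∃ a, x = i + a ∧ reflection m i j x = j + a ∧ f x = f i + a ∧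
      f (reflection m i j x) = f j + a) ∨
    (∃ a, x = j + a ∧ reflection m i j x = i + a ∧ f x = f j + a ∧
      f (reflection m i j x) = f i + a) ∨
    (reflection m i j x = x ∧ f (reflection m i j x) = f x) := by
  rcases reflection_cases (m := m) i j x with ⟨a, ha, h1, h2⟩ | ⟨a, ha, h1, h2⟩ | ⟨_, _, h2⟩
  · exact Or.inl ⟨a, h1, h2, by rw [h1, map_add H ha hi], by rw [h2, map_add H ha hj]⟩
  · exact Or.inr (Or.inl ⟨a, h1, h2, by rw [h1, map_add H ha hj], by rw [h2, map_add H ha hi]⟩)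
  · exact Or.inr (Or.inr ⟨h2, by rw [h2]⟩)

theorem reflection_lt_of_lt {x y : ℤ} (H : IsALPP m k S f) (hc : IsCrossing S f i j)
    (hxy : x < y) (hf : f x ≤ f y) (hr : f (reflection m i j y) < f (reflection m i j x)) :
    reflection m i j x < reflection m i j y := by
  obtain ⟨hi, hj, hij, hfij⟩ := hc
  rcases map_reflection_cases (x := x) H hi hj with ⟨a, hx⟩ | ⟨a, hx⟩ | hx <;>
  rcases map_reflection_cases (x := y) H hi hj with ⟨b, hy⟩ | ⟨b, hy⟩ | hy <;>
  omega

theorem not_dvd_of_isCrossing (H : IsALPP m k S f) (hc : IsCrossing S f i j) :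
    ¬ (m : ℤ) ∣ j - i := by
  intro h
  have := map_add H h hc.1
  rw [add_sub_cancel] at this
  have := hc.2.2.1
  have := hc.2.2.2
  omega

theorem crossCountA_comp_reflection_lt (hm : 1 ≤ m) (H : IsALPP m k S f)
    (hc : IsCrossing S f i j) :
    crossCountA m S (f ∘ reflection m i j) < crossCountA m S f := by
  have hd := not_dvd_of_isCrossing H hc
  have hmem : ∀ {x}, x ∈ S → reflection m i j x ∈ S := reflection_mem H hc.1 hc.2.1
  set t := reflection m i j with ht
  have htt : ∀ x, t (t x) = x := reflection_reflection hd
  have hta : ∀ {a} x, (m : ℤ) ∣ a → t (x + a) = t x + a := fun x ha => reflection_add ha x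
  let Y : Set (ℤ × ℤ) := {p | IsCrossing S f p.1 p.2 ∧ crossKeyA m p ≠ crossKeyA m (i, j)}
  have hYsub : crossKeyA m '' Y ⊆ crossingsA m S f := Set.image_mono fun p hp => hp.1
  have hYss : crossKeyA m '' Y ⊂ crossingsA m S f := by
    refine (Set.ssubset_iff_of_subset hYsub).2 ⟨_, ⟨(i, j), hc, rfl⟩, ?_⟩
    rintro ⟨p, hp, h⟩
    exact hp.2 h
  have hfin := finite_crossingsA hm H
  refine lt_of_le_of_lt ?_ (Set.ncard_lt_ncard hYss hfin)
  refine ncard_image_crossKeyA_le (fun p => if f p.2 < f p.1 then p else (t p.1, t p.2))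
    (hfin.subset hYsub) ?_ ?_
  · rintro ⟨x, y⟩ ⟨hx, hy, hxy, hf⟩
    dsimp only [Function.comp_apply] at hx hy hxy hf ⊢
    split_ifs with hlt
    · refine ⟨⟨hx, hy, hxy, hlt⟩, fun hk => ?_⟩
      obtain ⟨a, ha, h⟩ := crossKeyA_eq_iff.1 hk.symm
      simp only [Prod.mk.injEq] at h
      rw [h.1, h.2, ht, reflection_left ha, reflection_right hd ha, map_add H ha hc.1,
        map_add H ha hc.2.1] at hf
      have := hc.2.2.2
      omega
    · refine ⟨⟨hmem hx, hmem hy, reflection_lt_of_lt H hc hxy (not_lt.1 hlt) hf, hf⟩,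
        fun hk => ?_⟩
      obtain ⟨a, ha, h⟩ := crossKeyA_eq_iff.1 hk.symm
      simp only [Prod.mk.injEq] at h
      have h1 := congrArg t h.1
      have h2 := congrArg t h.2
      rw [htt, ht, reflection_left ha] at h1
      rw [htt, ht, reflection_right hd ha] at h2
      have := hc.2.2.1
      omega
  · rintro ⟨x, y⟩ ⟨hx, hy, hxy, hf⟩ ⟨x', y'⟩ ⟨hx', hy', hxy', hf'⟩ hk
    obtain ⟨a, ha, h⟩ := crossKeyA_eq_iff.1 hk
    rw [crossKeyA_eq_iff]
    dsimp only [Function.comp_apply] at hx hy hxy hf hx' hy' hxy' hf' h ⊢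
    split_ifs at h with h1 h2 h2 <;> simp only [Prod.mk.injEq] at h
    · exact ⟨a, ha, Prod.ext h.1 h.2⟩
    · rw [h.1, h.2, hta _ ha, hta _ ha, htt, htt, map_add H ha hx, map_add H ha hy] at hf'
      omega
    · rw [← htt x', ← htt y', h.1, h.2, hta _ ha, hta _ ha, map_add H ha (hmem hx),
        map_add H ha (hmem hy)] at h1
      omega
    · refine ⟨a, ha, Prod.ext ?_ ?_⟩
      · rw [← htt x', h.1, hta _ ha, htt]
      · rw [← htt y', h.2, hta _ ha, htt]

theorem crossCountA_comp_le (hm : 1 ≤ m) (H : IsALPP m k S f) {g : ℤ → ℤ}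
    (G : IsALPP m k (f '' S) g) :
    crossCountA m S (g ∘ f) ≤ crossCountA m S f + crossCountA m (f '' S) g := by
  let X : Set (ℤ × ℤ) := {p | IsCrossing S (g ∘ f) p.1 p.2 ∧ f p.1 ≤ f p.2}
  have hX : (crossKeyA m '' X).ncard ≤ crossCountA m (f '' S) g := by
    refine ncard_image_crossKeyA_le (fun p => (f p.1, f p.2)) (finite_crossingsA hm G) ?_ ?_
    · rintro ⟨x, y⟩ ⟨⟨hx, hy, hxy, hg⟩, hf⟩
      refine ⟨⟨x, hx, rfl⟩, ⟨y, hy, rfl⟩, lt_of_le_of_ne hf fun h => ?_, hg⟩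
      exact hxy.ne (injOn H hx hy h)
    · rintro ⟨x, y⟩ ⟨⟨hx, hy, hxy, hg⟩, hf⟩ ⟨x', y'⟩ ⟨⟨hx', hy', hxy', hg'⟩, hf'⟩ hk
      obtain ⟨a, ha, h⟩ := crossKeyA_eq_iff.1 hk
      simp only [Prod.mk.injEq] at h
      refine crossKeyA_eq_iff.2 ⟨a, ha, Prod.ext ?_ ?_⟩
      · exact injOn H hx' (add_mem H ha hx) (by rw [map_add H ha hx]; exact h.1)
      · exact injOn H hy' (add_mem H ha hy) (by rw [map_add H ha hy]; exact h.2)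
  have hXsub : crossKeyA m '' X ⊆ crossingsA m S (g ∘ f) := Set.image_mono fun p hp => hp.1
  have hsub : crossingsA m S (g ∘ f) ⊆ crossingsA m S f ∪ crossKeyA m '' X := by
    rintro _ ⟨p, hp, rfl⟩
    rcases lt_or_ge (f p.2) (f p.1) with h | h
    · exact Or.inl ⟨p, ⟨hp.1, hp.2.1, hp.2.2.1, h⟩, rfl⟩
    · exact Or.inr ⟨p, ⟨hp, h⟩, rfl⟩
  by_cases hfin : (crossingsA m S (g ∘ f)).Finite
  · have h1 := Set.ncard_le_ncard hsub ((finite_crossingsA hm H).union (hfin.subset hXsub))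
    have h2 := Set.ncard_union_le (crossingsA m S f) (crossKeyA m '' X)
    unfold crossCountA at *
    omega
  · rw [crossCountA, Set.Infinite.ncard hfin]
    exact Nat.zero_le _

theorem crossCountA_reflection_le_one (H : IsALPP m k S f) (hc : IsCrossing S f i j)
    (hgap : ∀ x ∈ S, i < x → j ≤ x) : crossCountA m S (reflection m i j) ≤ 1 := by
  have hgap' : ∀ {a x}, (m : ℤ) ∣ a → x ∈ S → i + a < x → j + a ≤ x := by
    intro a x ha hx h
    have := hgap _ (add_mem H (a := -a) (by simpa using ha) hx) (by omega)
    omega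
  have hlt := hc.2.2.1
  suffices h : crossingsA m S (reflection m i j) ⊆ {crossKeyA m (i, j)} from
    (Set.ncard_le_ncard h (Set.finite_singleton _)).trans (Set.ncard_singleton _).le
  rintro _ ⟨⟨x, y⟩, ⟨hx, hy, hxy, hr⟩, rfl⟩
  refine (crossKeyA_eq_iff.2 ?_).symm
  dsimp only at hx hy hxy hr ⊢
  have hry := reflection_mem H hc.1 hc.2.1 hy
  rcases reflection_cases (m := m) i j x with ⟨a, ha, h1, h2⟩ | ⟨a, ha, h1, h2⟩ | ⟨_, _, h2⟩ <;>
  rcases reflection_cases (m := m) i j y with ⟨b, hb, h3, h4⟩ | ⟨b, hb, h3, h4⟩ | ⟨_, _, h4⟩ <;>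
  rw [h2, h4] at hr
  case inl.inr.inl =>
    refine ⟨a, ha, Prod.ext h1 ?_⟩
    have := hgap' ha hy (by omega)
    by_contra hne
    have := hgap' ha (add_mem H hb hc.1) (by dsimp only at hne; omega)
    dsimp only at hne
    omega
  case inr.inr.inr.inl =>
    have := hgap' hb hx (by omega)
    omega
  case inl.inr.inr =>
    have := hgap' ha hy (by omega)
    omega
  all_goals omega

theorem exists_adjacent_crossing (h : ∃ i j, IsCrossing S f i j) :
    ∃ i j, IsCrossing S f i j ∧ ∀ x ∈ S, i < x → j ≤ x := by
  have h' : ∃ n : ℕ, ∃ i j, IsCrossing S f i j ∧ j - i = n := by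
    obtain ⟨i, j, hc⟩ := h
    exact ⟨(j - i).toNat, i, j, hc, by have := hc.2.2.1; omega⟩
  obtain ⟨i, j, hc, hn⟩ := Nat.find_spec h'
  refine ⟨i, j, hc, fun x hx hix => ?_⟩
  by_contra! hxj
  obtain ⟨hi, hj, hij, hf⟩ := hc
  rcases lt_or_ge (f x) (f i) with hlt | hge
  · exact Nat.find_min h' (m := (x - i).toNat) (by omega) ⟨i, x, ⟨hi, hx, hix, hlt⟩, by omega⟩
  · exact Nat.find_min h' (m := (j - x).toNat) (by omega)
      ⟨x, j, ⟨hx, hj, hxj, by omega⟩, by omega⟩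

end Length

section Weight

variable {S : Set ℤ} {f : ℤ → ℤ} {i j : ℤ} {l : ℕ}

theorem mem_weightSetA_iff {x : ℤ} :
    x ∈ weightSetA ((l : ℚ) + 1 / 2) S f ↔
      x ∈ S ∧ ((x ≤ l ∧ (l : ℤ) < f x) ∨ (f x ≤ l ∧ (l : ℤ) < x)) := by
  have h1 : ∀ y : ℤ, (y : ℚ) < (l : ℚ) + 1 / 2 ↔ y ≤ l := by
    intro y
    constructor
    · intro h
      by_contra! hlt
      have : ((l : ℤ) : ℚ) + 1 ≤ y := by exact_mod_cast hlt
      push_cast at this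
      linarith
    · intro h
      have : (y : ℚ) ≤ ((l : ℤ) : ℚ) := by exact_mod_cast h
      push_cast at this
      linarith
  have h2 : ∀ y : ℤ, (l : ℚ) + 1 / 2 < (y : ℚ) ↔ (l : ℤ) < y := by
    intro y
    constructor
    · intro h
      by_contra! hle
      have := (h1 y).2 hle
      linarith
    · intro h
      have : ((l : ℤ) : ℚ) + 1 ≤ y := by exact_mod_cast h
      push_cast at this
      linarith
  unfold weightSetA
  simp only [Set.mem_ofPred_eq, h1, h2]

theorem weightSetA_congr {a : ℚ} {g : ℤ → ℤ} (h : Set.EqOn f g S) :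
    weightSetA a S f = weightSetA a S g := by
  ext x
  simp only [weightSetA, Set.mem_ofPred_eq]
  exact and_congr_right fun hx => by rw [h hx]

theorem finite_weightSetA (hm : 1 ≤ m) (H : IsALPP m k S f) :
    (weightSetA ((l : ℚ) + 1 / 2) S f).Finite := by
  obtain ⟨B, hB⟩ := exists_displacement_bound hm H
  refine (Set.finite_Icc (l - B) (l + B)).subset fun x hx => ?_
  obtain ⟨hS, hx⟩ := mem_weightSetA_iff.1 hx
  have := abs_le.1 (hB x hS)
  rw [Set.mem_Icc]
  omega

theorem exists_ncard_weightSetA_comp (hm : 1 ≤ m) (H : IsALPP m k S f) {g : ℤ → ℤ}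
    (G : IsALPP m k (f '' S) g) :
    ∃ n, (weightSetA ((l : ℚ) + 1 / 2) S (g ∘ f)).ncard + 2 * n =
      (weightSetA ((l : ℚ) + 1 / 2) S f).ncard +
        (weightSetA ((l : ℚ) + 1 / 2) (f '' S) g).ncard := by
  set A := weightSetA ((l : ℚ) + 1 / 2) S f with hA
  set C := weightSetA ((l : ℚ) + 1 / 2) (f '' S) g with hC
  let B := {x | x ∈ S ∧ f x ∈ C}
  have hBC : f '' B = C := by
    ext y
    constructor
    · rintro ⟨x, hx, rfl⟩
      exact hx.2
    · intro hy
      obtain ⟨x, hx, rfl⟩ := hy.1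
      exact ⟨x, ⟨hx, hy⟩, rfl⟩
  have hinj : Set.InjOn f B := (injOn H).mono fun x hx => hx.1
  have hAfin : A.Finite := finite_weightSetA hm H
  have hBfin : B.Finite :=
    Set.Finite.of_finite_image (hBC ▸ finite_weightSetA hm G) hinj
  have hunion : weightSetA ((l : ℚ) + 1 / 2) S (g ∘ f) = (A \ B) ∪ (B \ A) := by
    ext x
    simp only [Set.mem_union, Set.mem_sdiff, B, Set.mem_ofPred_eq, hA, hC, mem_weightSetA_iff,
      Function.comp_apply]
    by_cases hx : x ∈ S
    · have : f x ∈ f '' S := ⟨x, hx, rfl⟩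
      simp only [hx, this, true_and]
      omega
    · simp [hx]
  refine ⟨(A ∩ B).ncard, ?_⟩
  rw [hunion, ← hBC, hinj.ncard_image, Set.ncard_union_eq
    (Set.disjoint_left.2 fun x hx hx' => hx.2 hx'.1) hAfin.sdiff hBfin.sdiff]
  have h1 := Set.ncard_inter_add_ncard_sdiff_eq_ncard A B hAfin
  have h2 := Set.ncard_inter_add_ncard_sdiff_eq_ncard B A hBfin
  rw [Set.inter_comm] at h2
  omega

theorem even_ncard_weightSetA_reflection (hm : 1 ≤ m)
    (H : IsALPP m k S (reflection m i j)) (hi : i ∈ S) (hj : j ∈ S) (hij : ¬ (m : ℤ) ∣ j - i) :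
    Even (weightSetA ((l : ℚ) + 1 / 2) S (reflection m i j)).ncard := by
  set t := reflection m i j
  have htt : ∀ x, t (t x) = x := reflection_reflection hij
  let U := {x | x ∈ S ∧ x ≤ l ∧ (l : ℤ) < t x}
  have himg : t '' U = {x | x ∈ S ∧ t x ≤ l ∧ (l : ℤ) < x} := by
    ext y
    constructor
    · rintro ⟨x, ⟨hx, h1, h2⟩, rfl⟩
      exact ⟨reflection_mem H hi hj hx, by rwa [htt], h2⟩
    · rintro ⟨hy, h1, h2⟩
      exact ⟨t y, ⟨reflection_mem H hi hj hy, h1, by rwa [htt]⟩, htt y⟩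
  have hunion : weightSetA ((l : ℚ) + 1 / 2) S t = U ∪ t '' U := by
    ext x
    rw [himg, mem_weightSetA_iff]
    simp only [U, Set.mem_union, Set.mem_ofPred_eq]
    tauto
  have hfin : U.Finite :=
    (finite_weightSetA (l := l) hm H).subset (hunion ▸ Set.subset_union_left)
  have hinj : Function.Injective t := Function.LeftInverse.injective htt
  rw [hunion, Set.ncard_union_eq _ hfin (hfin.image _), Set.ncard_image_of_injective _ hinj]
  · exact ⟨_, rfl⟩
  · rw [himg]
    refine Set.disjoint_left.2 fun x hx hx' => ?_
    have := hx.2.1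
    have := hx'.2.2
    omega

theorem ncard_weightSetA_comp_reflection_le (hm : 1 ≤ m) (H : IsALPP m k S f)
    (hc : IsCrossing S f i j) :
    (weightSetA ((l : ℚ) + 1 / 2) S (f ∘ reflection m i j)).ncard ≤
      (weightSetA ((l : ℚ) + 1 / 2) S f).ncard := by
  have hd := not_dvd_of_isCrossing H hc
  have hmem : ∀ {x}, x ∈ S → reflection m i j x ∈ S := reflection_mem H hc.1 hc.2.1
  set t := reflection m i j with ht
  have htt : ∀ x, t (t x) = x := reflection_reflection hd
  set A := weightSetA ((l : ℚ) + 1 / 2) S f with hA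
  have hlt := hc.2.2
  have key : ∀ x ∈ weightSetA ((l : ℚ) + 1 / 2) S (f ∘ t), x ∉ A →
      t x ∈ A ∧ t x ∉ weightSetA ((l : ℚ) + 1 / 2) S (f ∘ t) := by
    intro x hx hxA
    have hS := hx.1
    simp only [hA, mem_weightSetA_iff, Function.comp_apply, htt, hS, hmem hS, true_and]
      at hx hxA ⊢
    rcases map_reflection_cases (x := x) H hc.1 hc.2.1 with ⟨a, h⟩ | ⟨a, h⟩ | h <;>
    rw [← ht] at h <;> omega
  refine Set.ncard_le_ncard_of_injOn (fun x => if x ∈ A then x else t x) ?_ ?_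
    (finite_weightSetA hm H)
  · intro x hx
    split_ifs with h
    · exact h
    · exact (key x hx h).1
  · intro x hx y hy h
    dsimp only at h
    split_ifs at h with h1 h2 h2
    · exact h
    · exact absurd (h ▸ hx) (key y hy h2).2
    · exact absurd (h ▸ hy) (key x hx h1).2
    · rw [← htt x, h, htt]

end Weight

/-- The number of crossings of a basis element. -/
def len (p : AstIdx m k) : ℕ := crossCountA m p.1.1 p.1.2

/-- Twice the weight of a basis element at `l + 1/2`. -/
def wt (p : AstIdx m k) (l : Fin m) : ℕ := (weightSetA (((l : ℕ) : ℚ) + 1 / 2) p.1.1 p.1.2).ncard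

/-- `s` is the composite of `p` followed by `q`. -/
structure IsComp (p q s : AstIdx m k) : Prop where
  dom_right : q.1.1 = p.1.2 '' p.1.1
  dom : s.1.1 = p.1.1
  eqOn : Set.EqOn s.1.2 (q.1.2 ∘ p.1.2) p.1.1

/-- `q` is obtained from `p` by precomposition with the reflection exchanging `i` and `j`. -/
structure IsReflect (p : AstIdx m k) (i j : ℤ) (q : AstIdx m k) : Prop where
  mem_left : i ∈ p.1.1
  mem_right : j ∈ p.1.1
  not_dvd : ¬ (m : ℤ) ∣ j - i
  dom : q.1.1 = p.1.1
  eqOn : Set.EqOn q.1.2 (p.1.2 ∘ reflection m i j) p.1.1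

/-- `q` is a reflection of `p` with exactly one crossing less. -/
def Covers (p q : AstIdx m k) : Prop := (∃ i j, IsReflect p i j q) ∧ len q + 1 = len p

section Basis

variable {p p' q q' s s' u : AstIdx m k} {i j : ℤ}

theorem isALPP (p : AstIdx m k) : IsALPP m k p.1.1 p.1.2 := p.2.1

theorem astIdx_ext (hd : p.1.1 = q.1.1) (h : Set.EqOn p.1.2 q.1.2 p.1.1) : p = q := by
  refine Subtype.ext (Prod.ext hd (funext fun x => ?_))
  by_cases hx : x ∈ p.1.1
  · exact h hx
  · rw [p.2.2 x hx, q.2.2 x (hd ▸ hx)]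

theorem isALPP_congr {S : Set ℤ} {f g : ℤ → ℤ} (H : IsALPP m k S f) (h : Set.EqOn g f S) :
    IsALPP m k S g where
  invariant := H.invariant
  equivariant x hx := by rw [h hx, h ((H.invariant x).1 hx), H.equivariant x hx]
  orbits := H.orbits
  inj x hx y hy := by
    rw [h hx, h hy]
    exact H.inj x hx y hy

theorem isALPP_comp {S : Set ℤ} {f g : ℤ → ℤ} (H : IsALPP m k S f)
    (G : IsALPP m k (f '' S) g) : IsALPP m k S (g ∘ f) where
  invariant := H.invariant
  equivariant x hx := by
    simp only [Function.comp_apply]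
    rw [H.equivariant x hx, G.equivariant _ ⟨x, hx, rfl⟩]
  orbits := H.orbits
  inj x hx y hy h := H.inj x hx y hy (G.inj _ ⟨x, hx, rfl⟩ _ ⟨y, hy, rfl⟩ h)

theorem exists_astIdx_eqOn {S : Set ℤ} {f : ℤ → ℤ} (H : IsALPP m k S f) :
    ∃ p : AstIdx m k, p.1.1 = S ∧ Set.EqOn p.1.2 f S := by
  have h : Set.EqOn (fun x => if x ∈ S then f x else x) f S := fun x hx => if_pos hx
  exact ⟨⟨(S, fun x => if x ∈ S then f x else x), isALPP_congr H h, fun x hx => if_neg hx⟩, rfl, h⟩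

theorem exists_isComp (h : q.1.1 = p.1.2 '' p.1.1) : ∃ s, IsComp p q s := by
  obtain ⟨s, hd, hs⟩ := exists_astIdx_eqOn (isALPP_comp (isALPP p) (h ▸ isALPP q))
  exact ⟨s, h, hd, hs⟩

theorem exists_isReflect (hi : i ∈ p.1.1) (hj : j ∈ p.1.1) (hij : ¬ (m : ℤ) ∣ j - i) :
    ∃ q, IsReflect p i j q := by
  obtain ⟨q, hd, hq⟩ := exists_astIdx_eqOn (isALPP_comp_reflection (isALPP p) hi hj hij)
  exact ⟨q, hi, hj, hij, hd, hq⟩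

theorem IsReflect.symm (h : IsReflect p i j q) : IsReflect q i j p where
  mem_left := h.dom ▸ h.mem_left
  mem_right := h.dom ▸ h.mem_right
  not_dvd := h.not_dvd
  dom := h.dom.symm
  eqOn x hx := by
    rw [h.dom] at hx
    simp only [Function.comp_apply]
    rw [h.eqOn (reflection_mem (isALPP p) h.mem_left h.mem_right hx), Function.comp_apply,
      reflection_reflection h.not_dvd]

theorem IsReflect.comm (h : IsReflect p i j q) : IsReflect p j i q where
  mem_left := h.mem_right
  mem_right := h.mem_left
  not_dvd := by rw [dvd_sub_comm]; exact h.not_dvd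
  dom := h.dom
  eqOn x hx := by
    rw [h.eqOn hx, Function.comp_apply, Function.comp_apply, reflection_comm h.not_dvd]

theorem IsReflect.unique (h : IsReflect p i j q) (h' : IsReflect p i j q') : q = q' := by
  refine astIdx_ext (h.dom.trans h'.dom.symm) fun x hx => ?_
  rw [h.dom] at hx
  rw [h.eqOn hx, h'.eqOn hx]

theorem IsReflect.image_eq (h : IsReflect p i j q) : q.1.2 '' q.1.1 = p.1.2 '' p.1.1 := by
  rw [h.dom, Set.image_congr h.eqOn]
  exact image_comp_reflection (isALPP p) h.mem_left h.mem_right h.not_dvd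

theorem IsComp.unique (h : IsComp p q s) (h' : IsComp p q s') : s = s' := by
  refine astIdx_ext (h.dom.trans h'.dom.symm) fun x hx => ?_
  rw [h.dom] at hx
  rw [h.eqOn hx, h'.eqOn hx]

theorem IsComp.unique_left (h : IsComp p q s) (h' : IsComp p' q s) : p = p' := by
  have hd := h.dom.symm.trans h'.dom
  refine astIdx_ext hd fun x hx => injOn (isALPP q) ?_ ?_ ((h.eqOn hx).symm.trans ?_)
  · exact h.dom_right ▸ ⟨x, hx, rfl⟩
  · exact h'.dom_right ▸ ⟨x, hd ▸ hx, rfl⟩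
  · exact h'.eqOn (hd ▸ hx)

theorem IsComp.unique_right (h : IsComp p q s) (h' : IsComp p q' s) : q = q' := by
  refine astIdx_ext (h.dom_right.trans h'.dom_right.symm) fun x hx => ?_
  rw [h.dom_right] at hx
  obtain ⟨y, hy, rfl⟩ := hx
  exact (h.eqOn hy).symm.trans (h'.eqOn hy)

theorem IsComp.len_le (hm : 1 ≤ m) (h : IsComp p q s) : len s ≤ len p + len q := by
  have hle := crossCountA_comp_le hm (isALPP p) (h.dom_right ▸ isALPP q)
  unfold len
  rwa [h.dom, crossCountA_congr h.eqOn, h.dom_right]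

theorem IsComp.exists_wt (hm : 1 ≤ m) (h : IsComp p q s) (l : Fin m) :
    ∃ n, wt s l + 2 * n = wt p l + wt q l := by
  have hle := exists_ncard_weightSetA_comp (l := l) hm (isALPP p) (h.dom_right ▸ isALPP q)
  unfold wt
  rwa [h.dom, weightSetA_congr h.eqOn, h.dom_right]

theorem IsReflect.len_lt (hm : 1 ≤ m) (h : IsReflect p i j q) (hij : i < j)
    (hf : p.1.2 j < p.1.2 i) : len q < len p := by
  have := crossCountA_comp_reflection_lt hm (isALPP p) ⟨h.mem_left, h.mem_right, hij, hf⟩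
  unfold len
  rwa [h.dom, crossCountA_congr h.eqOn]

theorem IsReflect.lt_len (hm : 1 ≤ m) (h : IsReflect p i j q) (hij : i < j)
    (hf : p.1.2 i < p.1.2 j) : len p < len q := by
  refine h.symm.len_lt hm hij ?_
  have hl : reflection m i j i = j := by
    simpa using reflection_left (i := i) (j := j) (dvd_zero (m : ℤ))
  have hr : reflection m i j j = i := by
    simpa using reflection_right h.not_dvd (dvd_zero (m : ℤ))
  rwa [h.eqOn h.mem_left, h.eqOn h.mem_right, Function.comp_apply, Function.comp_apply, hl, hr]

theorem IsReflect.map_ne (h : IsReflect p i j q) : p.1.2 i ≠ p.1.2 j := by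
  intro heq
  have := injOn (isALPP p) h.mem_left h.mem_right heq
  exact h.not_dvd (by simp [this])

theorem IsReflect.ne (h : IsReflect p i j q) : i ≠ j := by
  rintro rfl
  exact h.map_ne rfl

theorem IsReflect.len_lt_iff (hm : 1 ≤ m) (h : IsReflect p i j q) :
    len q < len p ↔ (i < j ↔ p.1.2 j < p.1.2 i) := by
  have h1 := h.ne
  have h2 := h.map_ne
  have a1 := h.len_lt hm
  have a2 := h.lt_len hm
  have a3 := h.comm.len_lt hm
  have a4 := h.comm.lt_len hm
  omega

theorem IsReflect.len_ne (hm : 1 ≤ m) (h : IsReflect p i j q) : len q ≠ len p := by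
  have h1 := h.ne
  have h2 := h.map_ne
  have a1 := h.len_lt hm
  have a2 := h.lt_len hm
  have a3 := h.comm.len_lt hm
  have a4 := h.comm.lt_len hm
  omega

theorem IsReflect.exists_crossing (hm : 1 ≤ m) (h : IsReflect p i j q) (hlt : len q < len p) :
    ∃ i j, IsCrossing p.1.1 p.1.2 i j ∧ IsReflect p i j q := by
  have := (h.len_lt_iff hm).1 hlt
  have := h.map_ne
  rcases h.ne.lt_or_gt with hij | hij
  · exact ⟨i, j, ⟨h.mem_left, h.mem_right, hij, by omega⟩, h⟩
  · exact ⟨j, i, ⟨h.mem_right, h.mem_left, hij, by omega⟩, h.comm⟩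

/-- The reflection itself, as a basis element. -/
theorem exists_reflection_isComp (h : IsReflect p i j q) :
    ∃ s : AstIdx m k, s.1.1 = p.1.1 ∧ Set.EqOn s.1.2 (reflection m i j) p.1.1 ∧ IsComp s p q := by
  have Hid : IsALPP m k p.1.1 id :=
    ⟨(isALPP p).invariant, fun _ _ => rfl, (isALPP p).orbits, fun _ _ _ _ h => h⟩
  have HR := isALPP_comp_reflection Hid h.mem_left h.mem_right h.not_dvd
  obtain ⟨s, hd, hs⟩ := exists_astIdx_eqOn HR
  have himg : s.1.2 '' s.1.1 = p.1.1 := by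
    rw [hd, Set.image_congr hs]
    simpa using image_comp_reflection Hid h.mem_left h.mem_right h.not_dvd
  refine ⟨s, hd, hs, himg.symm, h.dom.trans hd.symm, fun x hx => ?_⟩
  rw [hd] at hx
  rw [h.eqOn hx, Function.comp_apply, Function.comp_apply, hs hx]
  rfl

theorem IsReflect.exists_wt (hm : 1 ≤ m) (h : IsReflect p i j q) (hlt : len q < len p)
    (l : Fin m) : ∃ n, wt q l + 2 * n = wt p l := by
  obtain ⟨i, j, hc, h⟩ := h.exists_crossing hm hlt
  obtain ⟨s, hd, hs, hcomp⟩ := exists_reflection_isComp h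
  obtain ⟨n, hn⟩ := hcomp.exists_wt hm l
  have heven : Even (wt s l) := by
    unfold wt
    rw [hd, weightSetA_congr hs]
    exact even_ncard_weightSetA_reflection hm (isALPP_congr (hd ▸ isALPP s) hs.symm) h.mem_left
      h.mem_right h.not_dvd
  have hle : wt q l ≤ wt p l := by
    unfold wt
    rw [h.dom, weightSetA_congr h.eqOn]
    exact ncard_weightSetA_comp_reflection_le hm (isALPP p) hc
  obtain ⟨c, hc⟩ := heven
  exact ⟨n - c, by omega⟩

theorem Covers.exists_wt (hm : 1 ≤ m) (h : Covers p q) (l : Fin m) :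
    ∃ n, wt q l + 2 * n = wt p l := by
  obtain ⟨⟨i, j, hr⟩, hlen⟩ := h
  exact hr.exists_wt hm (by omega) l

theorem IsComp.isReflect_of_left (hu : IsComp p q u) (h : IsReflect p i j p')
    (hs : IsComp p' q s) : IsReflect u i j s where
  mem_left := hu.dom ▸ h.mem_left
  mem_right := hu.dom ▸ h.mem_right
  not_dvd := h.not_dvd
  dom := by rw [hs.dom, h.dom, hu.dom]
  eqOn x hx := by
    rw [hu.dom] at hx
    rw [hs.eqOn (h.dom ▸ hx), Function.comp_apply, h.eqOn hx, Function.comp_apply,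
      Function.comp_apply, hu.eqOn (reflection_mem (isALPP p) h.mem_left h.mem_right hx),
      Function.comp_apply]

theorem IsComp.isReflect_of_right (hu : IsComp p q u) (hi : i ∈ p.1.1) (hj : j ∈ p.1.1)
    (h : IsReflect q (p.1.2 i) (p.1.2 j) q') (hs : IsComp p q' s) : IsReflect u i j s := by
  have hij : ¬ (m : ℤ) ∣ j - i := by
    intro hd
    have := map_add (isALPP p) hd hi
    rw [add_sub_cancel] at this
    exact h.not_dvd (by simpa [this] using hd)
  refine ⟨hu.dom ▸ hi, hu.dom ▸ hj, hij, hs.dom.trans hu.dom.symm, fun x hx => ?_⟩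
  rw [hu.dom] at hx
  rw [hs.eqOn hx, Function.comp_apply, h.eqOn (hu.dom_right ▸ ⟨x, hx, rfl⟩), Function.comp_apply,
    Function.comp_apply, hu.eqOn (reflection_mem (isALPP p) hi hj hx), Function.comp_apply,
    map_reflection (isALPP p) hi hj hij hx]

theorem IsComp.exists_left (hu : IsComp p q u) (h : IsReflect u i j s) :
    ∃ p', IsReflect p i j p' ∧ IsComp p' q s := by
  obtain ⟨p', hp'⟩ := exists_isReflect (hu.dom ▸ h.mem_left) (hu.dom ▸ h.mem_right) h.not_dvd
  obtain ⟨s', hs'⟩ := exists_isComp (p := p') (q := q) (by rw [hp'.image_eq, hu.dom_right])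
  refine ⟨p', hp', ?_⟩
  have hr := hu.isReflect_of_left hp' hs'
  rwa [h.unique hr]

theorem IsComp.exists_right (hu : IsComp p q u) (h : IsReflect u i j s) :
    ∃ q', IsReflect q (p.1.2 i) (p.1.2 j) q' ∧ IsComp p q' s := by
  have hi : i ∈ p.1.1 := hu.dom ▸ h.mem_left
  have hj : j ∈ p.1.1 := hu.dom ▸ h.mem_right
  obtain ⟨q', hq'⟩ := exists_isReflect (p := q) (i := p.1.2 i) (j := p.1.2 j)
    (hu.dom_right ▸ ⟨i, hi, rfl⟩) (hu.dom_right ▸ ⟨j, hj, rfl⟩)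
    fun hd => h.not_dvd (dvd_of_dvd_map (isALPP p) hi hj hd)
  obtain ⟨s', hs'⟩ := exists_isComp (p := p) (q := q') (by rw [hq'.dom, hu.dom_right])
  refine ⟨q', hq', ?_⟩
  have hr := hu.isReflect_of_right hi hj hq' hs'
  rwa [h.unique hr]

end Basis

section Leibniz

variable {p p' q q' s u : AstIdx m k} {i j : ℤ}

theorem IsReflect.translate {a : ℤ} (ha : (m : ℤ) ∣ a) (h : IsReflect p i j q) :
    IsReflect p (i + a) (j + a) q where
  mem_left := add_mem (isALPP p) ha h.mem_left
  mem_right := add_mem (isALPP p) ha h.mem_right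
  not_dvd := by simpa using h.not_dvd
  dom := h.dom
  eqOn x hx := by
    rw [h.eqOn hx, Function.comp_apply, Function.comp_apply]
    have hl : reflection m (i + a) (j + a) = reflection m i j := by
      funext x
      unfold reflection
      simp only [show x - (i + a) = x - i - a by ring, show x - (j + a) = x - j - a by ring,
        dvd_sub_left ha, add_sub_add_right_eq_sub]
    rw [hl]

theorem Covers.dom (h : Covers p q) : q.1.1 = p.1.1 := by
  obtain ⟨⟨i, j, hr⟩, -⟩ := h
  exact hr.dom

theorem Covers.image_eq (h : Covers p q) : q.1.2 '' q.1.1 = p.1.2 '' p.1.1 := by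
  obtain ⟨⟨i, j, hr⟩, -⟩ := h
  exact hr.image_eq

theorem finite_setOf_covers (hm : 1 ≤ m) (p : AstIdx m k) : {q | Covers p q}.Finite := by
  have hsub : ∀ c, {q | ∃ i j, crossKeyA m (i, j) = c ∧ IsReflect p i j q}.Subsingleton := by
    rintro c q ⟨i, j, rfl, h⟩ q' ⟨i', j', hk, h'⟩
    obtain ⟨a, ha, heq⟩ := crossKeyA_eq_iff.1 hk
    simp only [Prod.mk.injEq] at heq
    rw [heq.1, heq.2] at h
    exact h.unique (h'.translate ha)
  refine ((finite_crossingsA hm (isALPP p)).biUnion fun c _ => (hsub c).finite).subset ?_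
  rintro q ⟨⟨i, j, h⟩, hlen⟩
  obtain ⟨i, j, hc, h⟩ := h.exists_crossing hm (by omega)
  exact Set.mem_biUnion ⟨(i, j), hc, rfl⟩ ⟨i, j, rfl, h⟩

/-- When `t` and `t'` are corresponding reflections, the covering relation `p ∘ q ⋗ s` together
with additivity of lengths is the exclusive disjunction of the two Leibniz contributions. -/
theorem IsReflect.leibniz_iff (hm : 1 ≤ m) (hu : IsComp p q u) (h : IsReflect u i j s)
    (hp : IsReflect p i j p') (hps : IsComp p' q s)
    (hq : IsReflect q (p.1.2 i) (p.1.2 j) q') (hqs : IsComp p q' s) :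
    (len u = len p + len q ∧ len s + 1 = len u) ↔
      Xor (len p' + 1 = len p ∧ len s = len p' + len q)
        (len q' + 1 = len q ∧ len s = len p + len q') := by
  have h1 := h.len_lt_iff hm
  have h2 := hp.len_lt_iff hm
  have h3 := hq.len_lt_iff hm
  have n1 := h.len_ne hm
  have n2 := hp.len_ne hm
  have n3 := hq.len_ne hm
  have l1 := hu.len_le hm
  have l2 := hps.len_le hm
  have l3 := hqs.len_le hm
  have m1 := h.ne
  have m2 := hq.ne
  have m3 := hq.map_ne
  rw [hu.eqOn hp.mem_left, hu.eqOn hp.mem_right, Function.comp_apply, Function.comp_apply] at h1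
  have key : len s < len u ↔ ¬ (len p' < len p ↔ len q' < len q) := by
    rw [h1, h2, h3]
    omega
  unfold Xor
  omega

theorem leibniz_xor (hm : 1 ≤ m) (p q s : AstIdx m k) :
    (∃ t, (IsComp p q t ∧ len t = len p + len q) ∧ Covers t s) ↔
      Xor (∃ t, Covers p t ∧ IsComp t q s ∧ len s = len t + len q)
        (∃ t, Covers q t ∧ IsComp p t s ∧ len s = len p + len t) := by
  by_cases hT : q.1.1 = p.1.2 '' p.1.1
  swap
  · have hL : ¬ ∃ t, (IsComp p q t ∧ len t = len p + len q) ∧ Covers t s :=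
      fun ⟨t, ⟨h, _⟩, _⟩ => hT h.dom_right
    have hR1 : ¬ ∃ t, Covers p t ∧ IsComp t q s ∧ len s = len t + len q :=
      fun ⟨t, h, h', _⟩ => hT (h'.dom_right.trans h.image_eq)
    have hR2 : ¬ ∃ t, Covers q t ∧ IsComp p t s ∧ len s = len p + len t :=
      fun ⟨t, h, h', _⟩ => hT (h.dom.symm.trans h'.dom_right)
    simp [hL, hR1, hR2]
  obtain ⟨u, hu⟩ := exists_isComp hT
  by_cases hex : ∃ i j, IsReflect u i j s
  · obtain ⟨i, j, h⟩ := hex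
    obtain ⟨p', hp, hps⟩ := hu.exists_left h
    obtain ⟨q', hq, hqs⟩ := hu.exists_right h
    have hL : (∃ t, (IsComp p q t ∧ len t = len p + len q) ∧ Covers t s) ↔
        len u = len p + len q ∧ len s + 1 = len u := by
      constructor
      · rintro ⟨t, ⟨ht, h1⟩, _, h2⟩
        obtain rfl := ht.unique hu
        exact ⟨h1, h2⟩
      · rintro ⟨h1, h2⟩
        exact ⟨u, ⟨hu, h1⟩, ⟨i, j, h⟩, h2⟩
    have hR1 : (∃ t, Covers p t ∧ IsComp t q s ∧ len s = len t + len q) ↔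
        len p' + 1 = len p ∧ len s = len p' + len q := by
      constructor
      · rintro ⟨t, ⟨_, h1⟩, ht, h2⟩
        obtain rfl := ht.unique_left hps
        exact ⟨h1, h2⟩
      · rintro ⟨h1, h2⟩
        exact ⟨p', ⟨⟨i, j, hp⟩, h1⟩, hps, h2⟩
    have hR2 : (∃ t, Covers q t ∧ IsComp p t s ∧ len s = len p + len t) ↔
        len q' + 1 = len q ∧ len s = len p + len q' := by
      constructor
      · rintro ⟨t, ⟨_, h1⟩, ht, h2⟩
        obtain rfl := ht.unique_right hqs
        exact ⟨h1, h2⟩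
      · rintro ⟨h1, h2⟩
        exact ⟨q', ⟨⟨_, _, hq⟩, h1⟩, hqs, h2⟩
    rw [hL, hR1, hR2]
    exact h.leibniz_iff hm hu hp hps hq hqs
  · have hL : ¬ ∃ t, (IsComp p q t ∧ len t = len p + len q) ∧ Covers t s := by
      rintro ⟨t, ⟨ht, _⟩, h, _⟩
      obtain rfl := ht.unique hu
      exact hex h
    have hR1 : ¬ ∃ t, Covers p t ∧ IsComp t q s ∧ len s = len t + len q := by
      rintro ⟨t, ⟨⟨i, j, h⟩, _⟩, ht, _⟩
      exact hex ⟨i, j, hu.isReflect_of_left h ht⟩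
    have hR2 : ¬ ∃ t, Covers q t ∧ IsComp p t s ∧ len s = len p + len t := by
      rintro ⟨t, ⟨⟨a, b, h⟩, _⟩, ht, _⟩
      have ha := h.mem_left
      have hb := h.mem_right
      rw [hT] at ha hb
      obtain ⟨i, hi, rfl⟩ := ha
      obtain ⟨j, hj, rfl⟩ := hb
      exact hex ⟨i, j, hu.isReflect_of_right hi hj h ht⟩
    simp [hL, hR1, hR2]

end Leibniz

section StructureConstants

variable {p q s : AstIdx m k}

theorem mem_resCrossSetA_iff (hd : q.1.1 = p.1.1) {c : ZMod m × ℤ} :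
    c ∈ resCrossSetA m p.1.1 p.1.2 q.1.2 ↔
      ∃ i j, crossKeyA m (i, j) = c ∧ IsCrossing p.1.1 p.1.2 i j ∧ IsReflect p i j q ∧
        len q + 1 = len p := by
  constructor
  · rintro ⟨⟨i, j⟩, ⟨hc, heq, hlen⟩, rfl⟩
    refine ⟨i, j, rfl, hc, ⟨hc.1, hc.2.1, not_dvd_of_isCrossing (isALPP p) hc, hd, fun x hx => ?_⟩,
      ?_⟩
    · rw [← heq hx, resolveA_eq (isALPP p) hc.1 hc.2.1, Function.comp_apply]
    · rw [crossCountA_congr heq] at hlen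
      unfold len
      rwa [hd]
  · rintro ⟨i, j, rfl, hc, h, hlen⟩
    have heq : Set.EqOn (resolveA m p.1.2 i j) q.1.2 p.1.1 := fun x hx => by
      rw [h.eqOn hx, resolveA_eq (isALPP p) hc.1 hc.2.1, Function.comp_apply]
    refine ⟨(i, j), ⟨hc, heq, ?_⟩, rfl⟩
    unfold len at hlen
    rw [hd] at hlen
    rwa [crossCountA_congr heq]

theorem subsingleton_resCrossSetA (hd : q.1.1 = p.1.1) :
    (resCrossSetA m p.1.1 p.1.2 q.1.2).Subsingleton := by
  intro c hc c' hc'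
  obtain ⟨i, j, rfl, hx, h, -⟩ := (mem_resCrossSetA_iff hd).1 hc
  obtain ⟨i', j', rfl, hx', h', -⟩ := (mem_resCrossSetA_iff hd).1 hc'
  have e : p.1.2 (reflection m i j i) = p.1.2 (reflection m i' j' i) :=
    (h.eqOn hx.1).symm.trans (h'.eqOn hx.1)
  have e := injOn (isALPP p) (reflection_mem (isALPP p) hx.1 hx.2.1 hx.1)
    (reflection_mem (isALPP p) hx'.1 hx'.2.1 hx.1) e
  have hl : reflection m i j i = j := by
    simpa using reflection_left (i := i) (j := j) (dvd_zero (m : ℤ))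
  rw [hl] at e
  have hij := hx.2.2.1
  have hij' := hx'.2.2.1
  rcases reflection_cases (m := m) i' j' i with ⟨a, ha, h1, h2⟩ | ⟨a, ha, h1, h2⟩ | ⟨_, _, h2⟩
  · exact (crossKeyA_eq_iff.2 ⟨a, ha, Prod.ext h1 (e.trans h2)⟩).symm
  · omega
  · omega

theorem MdiffA_eq (hm : 1 ≤ m) (p q : AstIdx m k) :
    MdiffA m k p q =
      if Covers p q then MvPolynomial.monomial (expDiffA m p.1.1 p.1.2 q.1.2) 1 else 0 := by
  unfold MdiffA
  split_ifs with hd hcov hcov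
  · obtain ⟨⟨i, j, h⟩, hlen⟩ := hcov
    obtain ⟨i, j, hc, h⟩ := h.exists_crossing hm (by omega)
    rw [(subsingleton_resCrossSetA hd).eq_singleton_of_mem
      ((mem_resCrossSetA_iff hd).2 ⟨i, j, rfl, hc, h, hlen⟩), Set.ncard_singleton, Nat.cast_one]
  · have : resCrossSetA m p.1.1 p.1.2 q.1.2 = ∅ := by
      refine Set.eq_empty_of_forall_notMem fun c hc => ?_
      obtain ⟨i, j, -, -, h, hlen⟩ := (mem_resCrossSetA_iff hd).1 hc
      exact hcov ⟨⟨i, j, h⟩, hlen⟩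
    rw [this, Set.ncard_empty, Nat.cast_zero, map_zero]
  · exact absurd hcov.dom hd
  · rfl

theorem MmulA_eq (p q s : AstIdx m k) :
    MmulA m k p q s =
      if IsComp p q s ∧ len s = len p + len q then
        MvPolynomial.monomial (expMulA m p.1.1 q.1.1 p.1.2 q.1.2) 1
      else 0 := by
  unfold MmulA
  refine if_congr ⟨?_, ?_⟩ rfl rfl
  · rintro ⟨h1, h2, h3, h4⟩
    refine ⟨⟨h1, h3, h4⟩, ?_⟩
    unfold len
    rwa [h3, crossCountA_congr h4]
  · rintro ⟨h, hlen⟩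
    refine ⟨h.dom_right, ?_, h.dom, h.eqOn⟩
    unfold len at hlen
    rw [h.dom] at hlen
    rwa [← crossCountA_congr h.eqOn]

theorem expDiffA_apply (hd : q.1.1 = p.1.1) (l : Fin m) :
    expDiffA m p.1.1 p.1.2 q.1.2 l = (wt p l - wt q l) / 2 := by
  unfold wt
  rw [hd]
  rfl

theorem expMulA_apply (h : IsComp p q s) (l : Fin m) :
    expMulA m p.1.1 q.1.1 p.1.2 q.1.2 l = (wt p l + wt q l - wt s l) / 2 := by
  unfold wt
  rw [h.dom, weightSetA_congr h.eqOn]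
  rfl

theorem finsum_eq_ite_exists {ι M : Type*} [AddCommMonoid M] {F : ι → M} {P : ι → Prop} {c : M}
    (h : ∀ t, F t = if P t then c else 0) (huniq : ∀ t t', P t → P t' → t = t') :
    ∑ᶠ t, F t = if ∃ t, P t then c else 0 := by
  split_ifs with hex
  · obtain ⟨t, ht⟩ := hex
    rw [finsum_eq_single F t fun t' hne => ?_, h, if_pos ht]
    rw [h, if_neg fun ht' => hne (huniq _ _ ht' ht)]
  · refine finsum_eq_zero_of_forall_eq_zero fun t => ?_
    rw [h, if_neg fun ht => hex ⟨t, ht⟩]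

theorem ite_monomial_mul_ite {P Q : Prop} [Decidable P] [Decidable Q] {_ : Decidable (P ∧ Q)}
    {e e' c : Fin m →₀ ℕ} (h : P → Q → e + e' = c) :
    ((if P then MvPolynomial.monomial e 1 else 0) * (if Q then MvPolynomial.monomial e' 1 else 0) :
      AstRing m) = if P ∧ Q then MvPolynomial.monomial c 1 else 0 := by
  by_cases hP : P <;> by_cases hQ : Q <;> simp [hP, hQ, h]

theorem leibniz (hm : 1 ≤ m) (p q s : AstIdx m k) :
    ∑ᶠ t : AstIdx m k, MmulA m k p q t * MdiffA m k t s =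
      (∑ᶠ t : AstIdx m k, MdiffA m k p t * MmulA m k t q s) +
        (∑ᶠ t : AstIdx m k, MdiffA m k q t * MmulA m k p t s) := by
  obtain ⟨c, hc⟩ : ∃ c : Fin m →₀ ℕ, ∀ l, c l = (wt p l + wt q l - wt s l) / 2 :=
    ⟨Finsupp.equivFunOnFinite.symm fun l => (wt p l + wt q l - wt s l) / 2, fun l => rfl⟩
  rw [finsum_eq_ite_exists (c := MvPolynomial.monomial c 1)
      (P := fun t => (IsComp p q t ∧ len t = len p + len q) ∧ Covers t s),
    finsum_eq_ite_exists (c := MvPolynomial.monomial c 1)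
      (P := fun t => Covers p t ∧ IsComp t q s ∧ len s = len t + len q),
    finsum_eq_ite_exists (c := MvPolynomial.monomial c 1)
      (P := fun t => Covers q t ∧ IsComp p t s ∧ len s = len p + len t)]
  · have := leibniz_xor hm p q s
    generalize (∃ t, (IsComp p q t ∧ len t = len p + len q) ∧ Covers t s) = L at *
    generalize (∃ t, Covers p t ∧ IsComp t q s ∧ len s = len t + len q) = R1 at *
    generalize (∃ t, Covers q t ∧ IsComp p t s ∧ len s = len p + len t) = R2 at *
    by_cases h1 : R1 <;> by_cases h2 : R2 <;>
      simp [this, h1, h2, Xor, CharTwo.add_self_eq_zero]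
  · intro t
    rw [MdiffA_eq hm, MmulA_eq]
    refine ite_monomial_mul_ite fun h1 h2 => Finsupp.ext fun l => ?_
    rw [Finsupp.add_apply, hc, expMulA_apply h2.1, expDiffA_apply h1.dom]
    obtain ⟨n, hn⟩ := h1.exists_wt hm l
    obtain ⟨n', hn'⟩ := h2.1.exists_wt hm l
    omega
  · exact fun t t' h h' => h.2.1.unique_right h'.2.1
  · intro t
    rw [MdiffA_eq hm, MmulA_eq]
    refine ite_monomial_mul_ite fun h1 h2 => Finsupp.ext fun l => ?_
    rw [Finsupp.add_apply, hc, expMulA_apply h2.1, expDiffA_apply h1.dom]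
    obtain ⟨n, hn⟩ := h1.exists_wt hm l
    obtain ⟨n', hn'⟩ := h2.1.exists_wt hm l
    omega
  · exact fun t t' h h' => h.2.1.unique_left h'.2.1
  · intro t
    rw [MdiffA_eq hm, MmulA_eq]
    refine ite_monomial_mul_ite fun h1 h2 => Finsupp.ext fun l => ?_
    rw [Finsupp.add_apply, hc, expMulA_apply h1.1, expDiffA_apply h2.dom]
    obtain ⟨n, hn⟩ := h2.exists_wt hm l
    obtain ⟨n', hn'⟩ := h1.1.exists_wt hm l
    omega
  · exact fun t t' h h' => h.1.1.unique h'.1.1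

end StructureConstants

section LinearExtension

variable {R ι : Type*} [CommSemiring R]

/-- The linear endomorphism of the free module on `ι` with row-finite matrix `F`. -/
def linExt (F : ι → ι → R) (hF : ∀ p, (Function.support (F p)).Finite) :
    (ι →₀ R) →ₗ[R] (ι →₀ R) :=
  Finsupp.linearCombination R fun p => Finsupp.ofSupportFinite (F p) (hF p)

/-- The bilinear product on the free module on `ι` with structure constants `M`. -/
def bilinExt (M : ι → ι → ι → R) (hM : ∀ p q, (Function.support (M p q)).Finite) :
    (ι →₀ R) →ₗ[R] (ι →₀ R) →ₗ[R] (ι →₀ R) :=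
  Finsupp.linearCombination R fun p => linExt (M p) (hM p)

variable {F : ι → ι → R} {hF : ∀ p, (Function.support (F p)).Finite}
  {M : ι → ι → ι → R} {hM : ∀ p q, (Function.support (M p q)).Finite}

theorem linExt_apply (x : ι →₀ R) (s : ι) : linExt F hF x s = ∑ᶠ t, x t * F t s := by
  rw [linExt, Finsupp.linearCombination_apply, Finsupp.sum, Finsupp.finsetSum_apply,
    finsum_eq_sum_of_support_subset (s := x.support)]
  · rfl
  · intro t ht
    rw [Finset.mem_coe, Finsupp.mem_support_iff]
    exact left_ne_zero_of_mul ht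

theorem linExt_single (p : ι) (q : ι) : linExt F hF (Finsupp.single p 1) q = F p q := by
  rw [linExt, Finsupp.linearCombination_single, one_smul]
  rfl

theorem bilinExt_single_left (p : ι) :
    bilinExt M hM (Finsupp.single p 1) = linExt (M p) (hM p) := by
  rw [bilinExt, Finsupp.linearCombination_single, one_smul]

theorem bilinExt_single_right (x : ι →₀ R) (q : ι) :
    bilinExt M hM x (Finsupp.single q 1) = linExt (fun p => M p q) (fun p => hM p q) x := by
  rw [bilinExt, linExt, Finsupp.linearCombination_apply, Finsupp.linearCombination_apply,
    Finsupp.sum, LinearMap.sum_apply]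
  refine Finset.sum_congr rfl fun p _ => ?_
  rw [LinearMap.smul_apply]
  congr 1
  rw [linExt, Finsupp.linearCombination_single, one_smul]

theorem linExt_bilinExt
    (h : ∀ p q s, ∑ᶠ t, M p q t * F t s = ∑ᶠ t, F p t * M t q s + ∑ᶠ t, F q t * M p t s)
    (x y : ι →₀ R) :
    linExt F hF (bilinExt M hM x y) =
      bilinExt M hM (linExt F hF x) y + bilinExt M hM x (linExt F hF y) := by
  suffices H : (bilinExt M hM).compr₂ (linExt F hF) =
      (bilinExt M hM) ∘ₗ (linExt F hF) + (bilinExt M hM).compl₂ (linExt F hF) from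
    LinearMap.congr_fun₂ H x y
  ext p q s : 5
  simp only [LinearMap.comp_apply, LinearMap.compr₂_apply, LinearMap.add_apply,
    LinearMap.compl₂_apply, Finsupp.lsingle_apply, Finsupp.add_apply, bilinExt_single_left,
    bilinExt_single_right, linExt_apply (linExt _ _ _), linExt_single]
  exact h p q s

/-- In characteristic two the square of a derivation is a derivation. -/
theorem linExt_linExt_bilinExt [CharP R 2]
    (h : ∀ p q s, ∑ᶠ t, M p q t * F t s = ∑ᶠ t, F p t * M t q s + ∑ᶠ t, F q t * M p t s)
    (x y : ι →₀ R) :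
    linExt F hF (linExt F hF (bilinExt M hM x y)) =
      bilinExt M hM (linExt F hF (linExt F hF x)) y +
        bilinExt M hM x (linExt F hF (linExt F hF y)) := by
  have h2 (z : ι →₀ R) : z + z = 0 := Finsupp.ext fun s => CharTwo.add_self_eq_zero (z s)
  simp only [linExt_bilinExt h, _root_.map_add]
  rw [add_assoc, ← add_assoc (bilinExt M hM (linExt F hF x) (linExt F hF y)), h2, zero_add]

end LinearExtension

section Square

variable {p q s : AstIdx m k}

theorem finite_support_MdiffA (hm : 1 ≤ m) (p : AstIdx m k) :
    (Function.support (MdiffA m k p)).Finite :=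
  (finite_setOf_covers hm p).subset fun q hq => by
    by_contra hc
    exact hq ((MdiffA_eq hm p q).trans (if_neg hc))

theorem finite_support_MmulA (p q : AstIdx m k) : (Function.support (MmulA m k p q)).Finite := by
  refine Set.Subsingleton.finite fun s hs s' hs' => ?_
  have key : ∀ s, MmulA m k p q s ≠ 0 → IsComp p q s := fun s hs => by
    by_contra hc
    exact hs (by rw [MmulA_eq, if_neg fun h => hc h.1])
  exact (key s hs).unique (key s' hs')

theorem exists_factorization (hm : 1 ≤ m) (hp : 2 ≤ len p) :
    ∃ s g : AstIdx m k, IsComp s g p ∧ len p = len s + len g ∧ len s < len p ∧ len g < len p := by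
  have hex : ∃ i j, IsCrossing p.1.1 p.1.2 i j := by
    by_contra! hno
    have : crossingsA m p.1.1 p.1.2 = ∅ :=
      Set.eq_empty_of_forall_notMem fun c ⟨x, hx, _⟩ => hno x.1 x.2 hx
    rw [len, crossCountA, this, Set.ncard_empty] at hp
    omega
  obtain ⟨i, j, hc, hgap⟩ := exists_adjacent_crossing hex
  obtain ⟨g, hg⟩ := exists_isReflect hc.1 hc.2.1 (not_dvd_of_isCrossing (isALPP p) hc)
  obtain ⟨s, hd, hs, hcomp⟩ := exists_reflection_isComp hg.symm
  rw [hg.dom] at hd hs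
  have h1 : len s ≤ 1 := by
    unfold len
    rw [hd, crossCountA_congr hs]
    exact crossCountA_reflection_le_one (isALPP p) hc hgap
  have h2 := hg.len_lt hm hc.2.2.1 hc.2.2.2
  have h3 := hcomp.len_le hm
  exact ⟨s, g, hcomp, by omega, by omega, h2⟩

theorem linExt_MdiffA_sq (hm : 1 ≤ m) (p : AstIdx m k) :
    linExt (MdiffA m k) (finite_support_MdiffA hm)
      (linExt (MdiffA m k) (finite_support_MdiffA hm) (Finsupp.single p 1)) = 0 := by
  induction hn : len p using Nat.strong_induction_on generalizing p with
  | _ n ih =>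
    subst hn
    rcases lt_or_ge (len p) 2 with hp | hp
    · ext1 r
      rw [linExt_apply, Finsupp.zero_apply]
      refine finsum_eq_zero_of_forall_eq_zero fun q => ?_
      rw [linExt_single, MdiffA_eq hm, MdiffA_eq hm]
      split_ifs with h1 h2
      · have := h1.2
        have := h2.2
        omega
      all_goals simp
    · obtain ⟨s, g, hcomp, hlen, hs, hg⟩ := exists_factorization hm hp
      have hmul : bilinExt (MmulA m k) finite_support_MmulA (Finsupp.single s 1)
          (Finsupp.single g 1) =
          (MvPolynomial.monomial (expMulA m s.1.1 g.1.1 s.1.2 g.1.2) 1 : AstRing m) •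
            Finsupp.single p 1 := by
        ext1 t
        rw [bilinExt_single_left, linExt_single, MmulA_eq, Finsupp.smul_apply]
        by_cases ht : p = t
        · subst ht
          rw [if_pos ⟨hcomp, hlen⟩, Finsupp.single_eq_same, smul_eq_mul, mul_one]
        · rw [if_neg fun h => ht (hcomp.unique h.1), Finsupp.single_apply, if_neg ht, smul_zero]
      have key := linExt_linExt_bilinExt (hF := finite_support_MdiffA hm)
        (hM := finite_support_MmulA) (leibniz hm) (Finsupp.single s 1) (Finsupp.single g 1)
      rw [hmul, ih _ hs s rfl, ih _ hg g rfl, map_zero, map_zero, LinearMap.zero_apply, add_zero,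
        map_smul, map_smul] at key
      refine (smul_eq_zero.1 key).resolve_left ?_
      exact fun h => one_ne_zero (MvPolynomial.monomial_eq_zero.1 h)

end Square

end Asteroids

/-- The asteroids algebra `A(m, k)` is a differential graded
algebra: its differential squares to zero and satisfies the Leibniz rule with
respect to its product (coefficients in `F₂`).  Since `A(m, k)` is the free
`F₂[v₁, …, v_m]`-module on the set of `mℤ`-lifted partial permutations, with
`∂` linear with structure constants `MdiffA` and `μ₂` bilinear with structure
constants `MmulA`, both assertions are expressed by the equality of all matrix
coefficients. -/
theorem asteroids_dga (m k : ℕ) (hm : 1 ≤ m) (hk1 : 1 ≤ k) (hkm : k ≤ m) :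
    (∀ p r : AstIdx m k,
      ∑ᶠ q : AstIdx m k, MdiffA m k p q * MdiffA m k q r = 0) ∧
    (∀ p q s : AstIdx m k,
      ∑ᶠ t : AstIdx m k, MmulA m k p q t * MdiffA m k t s =
        (∑ᶠ t : AstIdx m k, MdiffA m k p t * MmulA m k t q s) +
          (∑ᶠ t : AstIdx m k, MdiffA m k q t * MmulA m k p t s)) := by
  refine ⟨fun p r => ?_, Asteroids.leibniz hm⟩
  have h := DFunLike.congr_fun (Asteroids.linExt_MdiffA_sq hm p) r
  rw [Asteroids.linExt_apply, Finsupp.zero_apply] at h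
  simpa only [Asteroids.linExt_single] using h
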